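/- For every integer n ≥ 3, the spanning subgraph A'[n,2] of the accordion graph A[n,2], obtained by deleting the four edges u_1 u_n, v_1 v_n, u_{n-1} v_1 and u_n v_2 from A[n,2], has the PH-property: for every pairing M of A'[n,2] there exists a perfect matching N of A'[n,2] such that M ∪ N is the edge set of a Hamiltonian cycle of the complete graph on the vertices of A'[n,2]. -/

import Mathlib

open SimpleGraph

/-- The accordion graph `A[n,k]`: vertices `u_i = (false, i)` and `v_i = (true, i)`
for `i : ZMod n`, with edges `u_i u_{i+1}`, `v_i v_{i+1}`, `u_i v_i`, `u_i v_{i+k}`. -/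
def accordion (n k : ℕ) : SimpleGraph (Bool × ZMod n) :=
  SimpleGraph.fromRel (fun x y =>
    (x.1 = y.1 ∧ y.2 = x.2 + 1) ∨
    (x.1 = false ∧ y.1 = true ∧ (y.2 = x.2 ∨ y.2 = x.2 + (k : ZMod n))))

/-- A graph `G` has the PH-property if every pairing `M` of `G` (a perfect matching of the
complete graph `⊤` on the vertex set of `G`) extends to a Hamiltonian cycle of `K_G`, i.e.
there is a perfect matching `N` of `G` such that `M ∪ N` is the edge set of a Hamiltonian
cycle of the complete graph on the vertices of `G`. -/
def IsPH {V : Type} [DecidableEq V] (G : SimpleGraph V) : Prop :=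
  ∀ M : (⊤ : SimpleGraph V).Subgraph, M.IsPerfectMatching →
    ∃ N : G.Subgraph, N.IsPerfectMatching ∧
      ∃ (v : V) (c : (⊤ : SimpleGraph V).Walk v v), c.IsHamiltonianCycle ∧
        {e | e ∈ c.edges} = M.edgeSet ∪ N.edgeSet

open scoped symmDiff

section Involution

variable {V : Type*} {f : V → V}

/-- The graph joining every vertex `v` to `f v`. -/
def involutionGraph (f : V → V) : SimpleGraph V :=
  SimpleGraph.fromRel (fun x y => f x = y)

lemma involutionGraph_adj (hf : Function.Involutive f) (hne : ∀ v, f v ≠ v) {x y : V} :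
    (involutionGraph f).Adj x y ↔ f x = y := by
  simp only [involutionGraph, SimpleGraph.fromRel_adj]
  constructor
  · rintro ⟨-, h | h⟩
    · exact h
    · rw [← h, hf y]
  · rintro rfl
    exact ⟨(hne x).symm, Or.inl rfl⟩

/-- The subgraph of `G` whose edges join every vertex `v` to `f v`. -/
def involutionSubgraph (G : SimpleGraph V) (f : V → V) (hf : Function.Involutive f)
    (hG : ∀ v, G.Adj v (f v)) : G.Subgraph where
  verts := Set.univ
  Adj x y := f x = y
  adj_sub := by
    rintro x y rfl
    exact hG x
  edge_vert _ := Set.mem_univ _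
  symm := ⟨fun x y h => by rw [← h, hf x]⟩

lemma involutionSubgraph_isPerfectMatching (G : SimpleGraph V) (hf : Function.Involutive f)
    (hG : ∀ v, G.Adj v (f v)) : (involutionSubgraph G f hf hG).IsPerfectMatching :=
  SimpleGraph.Subgraph.isPerfectMatching_iff.2 fun v => ⟨f v, rfl, fun _ h => Eq.symm h⟩

lemma involutionSubgraph_spanningCoe (G : SimpleGraph V) (hf : Function.Involutive f)
    (hG : ∀ v, G.Adj v (f v)) :
    (involutionSubgraph G f hf hG).spanningCoe = involutionGraph f := by
  ext x y
  rw [involutionGraph_adj hf fun v => (hG v).ne']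
  rfl

lemma symmDiff_involutionGraph_isCycles {G : SimpleGraph V} {M : G.Subgraph}
    (hM : M.IsPerfectMatching) (hf : Function.Involutive f) (hne : ∀ v, f v ≠ v) :
    (M.spanningCoe ∆ involutionGraph f).IsCycles := by
  have h := hM.symmDiff_isCycles
    (involutionSubgraph_isPerfectMatching ⊤ hf fun v => (hne v).symm)
  rwa [involutionSubgraph_spanningCoe] at h

end Involution

section Swap

variable {V : Type*} [DecidableEq V] {f : V → V} {p q : V}

/-- Conjugating `f` by the transposition of `p` and `q`. -/
def swapConj (p q : V) (f : V → V) (x : V) : V :=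
  Equiv.swap p q (f (Equiv.swap p q x))

lemma swapConj_comm (p q : V) (f : V → V) : swapConj p q f = swapConj q p f := by
  funext x
  simp only [swapConj, Equiv.swap_comm]

lemma swapConj_involutive (hf : Function.Involutive f) :
    Function.Involutive (swapConj p q f) := fun x => by
  simp [swapConj, hf _]

lemma swapConj_ne (hne : ∀ v, f v ≠ v) (v : V) : swapConj p q f v ≠ v := fun h => by
  apply hne (Equiv.swap p q v)
  apply (Equiv.swap p q).injective
  simpa [swapConj] using h

lemma swapConj_of_ne (hf : Function.Involutive f) {x : V} (h1 : x ≠ p) (h2 : x ≠ q)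
    (h3 : x ≠ f p) (h4 : x ≠ f q) : swapConj p q f x = f x := by
  rw [swapConj, Equiv.swap_apply_of_ne_of_ne h1 h2, Equiv.swap_apply_of_ne_of_ne]
  · rintro rfl
    exact h3 (hf x).symm
  · rintro rfl
    exact h4 (hf x).symm

variable [Finite V] {G : SimpleGraph V} {M : G.Subgraph}

lemma reachable_swapConj_apply (hM : M.IsPerfectMatching) (hf : Function.Involutive f)
    (hne : ∀ v, f v ≠ v)
    (hpq : ¬ (M.spanningCoe ⊔ involutionGraph f).Reachable p q) :
    (M.spanningCoe ⊔ involutionGraph (swapConj p q f)).Reachable p (f p) := by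
  by_cases hMp : M.Adj p (f p)
  · exact SimpleGraph.Adj.reachable (Or.inl hMp)
  set C := M.spanningCoe ∆ involutionGraph f with hC
  set D := C.deleteEdges {s(p, f p)} with hD
  have hCp : C.Adj p (f p) := by
    rw [hC, symmDiff_def]
    exact Or.inr ⟨(involutionGraph_adj hf hne).2 rfl, hMp⟩
  have hreach : D.Reachable p (f p) :=
    (symmDiff_involutionGraph_isCycles hM hf hne).reachable_deleteEdges hCp
  have hle : D ≤ M.spanningCoe ⊔ involutionGraph f :=
    (SimpleGraph.deleteEdges_le _).trans symmDiff_le_sup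
  have key : ∀ x, D.Reachable p x →
      (M.spanningCoe ⊔ involutionGraph (swapConj p q f)).Reachable p x := by
    intro x hx
    rw [SimpleGraph.reachable_iff_reflTransGen] at hx
    induction hx with
    | refl => rfl
    | @tail x y hx hxy ih =>
      refine ih.trans (SimpleGraph.Adj.reachable ?_)
      have hpx : (M.spanningCoe ⊔ involutionGraph f).Reachable p x :=
        ((SimpleGraph.reachable_iff_reflTransGen _ _).2 hx).mono hle
      rcases hle hxy with h | h
      · exact Or.inl h
      · have hdel : s(x, y) ≠ s(p, f p) := (SimpleGraph.deleteEdges_adj.1 hxy).2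
        rw [involutionGraph_adj hf hne] at h
        subst h
        refine Or.inr ((involutionGraph_adj (swapConj_involutive hf) (swapConj_ne hne)).2 ?_)
        apply swapConj_of_ne hf
        · rintro rfl
          exact hdel rfl
        · rintro rfl
          exact hpq hpx
        · rintro rfl
          exact hdel (by rw [hf p, Sym2.eq_swap])
        · rintro rfl
          exact hpq (hpx.trans (SimpleGraph.Adj.reachable
            (Or.inr ((involutionGraph_adj hf hne).2 (hf q)))))
  exact key _ hreach

lemma reachable_swapConj (hM : M.IsPerfectMatching) (hf : Function.Involutive f)
    (hne : ∀ v, f v ≠ v)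
    (hpq : ¬ (M.spanningCoe ⊔ involutionGraph f).Reachable p q) {x y : V}
    (hxy : (M.spanningCoe ⊔ involutionGraph f).Reachable x y) :
    (M.spanningCoe ⊔ involutionGraph (swapConj p q f)).Reachable x y := by
  have hp := reachable_swapConj_apply hM hf hne hpq
  have hq := reachable_swapConj_apply hM hf hne fun h => hpq h.symm
  rw [swapConj_comm] at hq
  rw [SimpleGraph.reachable_iff_reflTransGen] at hxy
  induction hxy with
  | refl => rfl
  | @tail x y _ hxy ih =>
    refine ih.trans ?_
    rcases hxy with h | h
    · exact SimpleGraph.Adj.reachable (Or.inl h)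
    rw [involutionGraph_adj hf hne] at h
    subst h
    by_cases h1 : x = p
    · rw [h1]; exact hp
    by_cases h2 : x = q
    · rw [h2]; exact hq
    by_cases h3 : x = f p
    · rw [h3, hf p]; exact hp.symm
    by_cases h4 : x = f q
    · rw [h4, hf q]; exact hq.symm
    refine SimpleGraph.Adj.reachable
      (Or.inr ((involutionGraph_adj (swapConj_involutive hf) (swapConj_ne hne)).2 ?_))
    exact swapConj_of_ne hf h1 h2 h3 h4

lemma reachable_swapConj_pair (hM : M.IsPerfectMatching) (hf : Function.Involutive f)
    (hne : ∀ v, f v ≠ v)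
    (hpq : ¬ (M.spanningCoe ⊔ involutionGraph f).Reachable p q) :
    (M.spanningCoe ⊔ involutionGraph (swapConj p q f)).Reachable p q := by
  have hq := reachable_swapConj_apply hM hf hne fun h => hpq h.symm
  rw [swapConj_comm] at hq
  have hfq : f q ≠ p := by
    rintro rfl
    exact hpq (SimpleGraph.Adj.reachable (Or.inr ((involutionGraph_adj hf hne).2 (hf q))))
  refine SimpleGraph.Reachable.trans (SimpleGraph.Adj.reachable ?_) hq.symm
  refine Or.inr ((involutionGraph_adj (swapConj_involutive hf) (swapConj_ne hne)).2 ?_)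
  rw [swapConj, Equiv.swap_apply_left, Equiv.swap_apply_of_ne_of_ne hfq (hne q)]

end Swap

section Layers

variable {V : Type*} {f : V → V} {G : SimpleGraph V} {M : G.Subgraph}

/-- An involution pairing vertices of consecutive layers, with at least one pair between any two
consecutive layers among `0, …, n`. -/
structure IsLayered (col : V → ℕ) (n : ℕ) (f : V → V) : Prop where
  involutive : Function.Involutive f
  step : ∀ v, col (f v) = col v + 1 ∨ col v = col (f v) + 1
  link : ∀ i < n, ∃ v, col v = i ∧ col (f v) = i + 1

variable {col : V → ℕ} {n : ℕ}

lemma IsLayered.ne (h : IsLayered col n f) (v : V) : f v ≠ v := fun hv => by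
  have := h.step v
  rw [hv] at this
  omega

lemma IsLayered.swapConj [DecidableEq V] (h : IsLayered col n f) {p q : V} (hpq : col p = col q) :
    IsLayered col n (swapConj p q f) := by
  have hs : ∀ x, col (Equiv.swap p q x) = col x := by
    intro x
    rw [Equiv.swap_apply_def]
    split_ifs with h1 h2
    · rw [h1, hpq]
    · rw [h2, hpq]
    · rfl
  refine ⟨swapConj_involutive h.involutive, fun v => ?_, fun i hi => ?_⟩
  · have := h.step (Equiv.swap p q v)
    rw [hs] at this
    simpa only [_root_.swapConj, hs] using this
  · obtain ⟨v, h1, h2⟩ := h.link i hi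
    exact ⟨Equiv.swap p q v, by rw [hs, h1], by simp [_root_.swapConj, hs, h2]⟩

lemma IsLayered.exists_preconnected [Finite V] (hM : M.IsPerfectMatching) (hcol : ∀ v, col v ≤ n)
    (hf : IsLayered col n f) :
    ∃ g, IsLayered col n g ∧ (M.spanningCoe ⊔ involutionGraph g).Preconnected := by
  classical
  let R (g : V → V) : Set (V × V) :=
    {x | (M.spanningCoe ⊔ involutionGraph g).Reachable x.1 x.2}
  have : Nonempty {g // IsLayered col n g} := ⟨⟨f, hf⟩⟩
  obtain ⟨⟨g, hg⟩, hmax⟩ :=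
    Finite.exists_max (fun g : {g // IsLayered col n g} => (R g.1).ncard)
  have hlayer : ∀ p q, col p = col q →
      (M.spanningCoe ⊔ involutionGraph g).Reachable p q := by
    intro p q hpq
    by_contra hnot
    refine absurd (hmax ⟨_, hg.swapConj hpq⟩) (not_le.2 (Set.ncard_lt_ncard ?_ (Set.toFinite _)))
    refine Set.ssubset_iff_exists.2 ⟨fun x hx => ?_, (p, q), ?_, hnot⟩
    · exact reachable_swapConj hM hg.involutive hg.ne hnot hx
    · exact reachable_swapConj_pair hM hg.involutive hg.ne hnot
  have hup : ∀ d i x y, col x = i → col y = i + d →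
      (M.spanningCoe ⊔ involutionGraph g).Reachable x y := by
    intro d
    induction d with
    | zero => exact fun i x y hx hy => hlayer x y (by omega)
    | succ d ih =>
      intro i x y hx hy
      obtain ⟨v, hv, hgv⟩ := hg.link i (by have := hcol y; omega)
      refine (hlayer x v (by omega)).trans (SimpleGraph.Reachable.trans
        (SimpleGraph.Adj.reachable ?_) (ih (i + 1) (g v) y hgv (by omega)))
      exact Or.inr ((involutionGraph_adj hg.involutive hg.ne).2 rfl)
  refine ⟨g, hg, fun x y => ?_⟩
  rcases le_total (col x) (col y) with h | h
  · exact hup (col y - col x) _ x y rfl (by omega)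
  · exact (hup (col x - col y) _ y x rfl (by omega)).symm

end Layers

section HamiltonianCycle

variable {V : Type*} [Finite V]

lemma disjoint_involutionGraph {f : V → V} {G : SimpleGraph V} {M : G.Subgraph}
    (hM : M.IsPerfectMatching) (hf : Function.Involutive f) (hne : ∀ v, f v ≠ v)
    (hconn : (M.spanningCoe ⊔ involutionGraph f).Preconnected) (hcard : 2 < Nat.card V) :
    Disjoint M.spanningCoe (involutionGraph f) := by
  rw [SimpleGraph.disjoint_left]
  intro x y hM1 hf1
  rw [involutionGraph_adj hf hne] at hf1
  subst hf1
  have hmem : ∀ z, z ∈ ({x, f x} : Set V) := by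
    intro z
    have hz := hconn x z
    rw [SimpleGraph.reachable_iff_reflTransGen] at hz
    induction hz with
    | refl => simp
    | @tail a b _ hab ih =>
      rcases hab with h | h
      · rcases ih with rfl | rfl
        · exact Or.inr (hM.1.eq_of_adj_left h hM1)
        · exact Or.inl (hM.1.eq_of_adj_left h hM1.symm)
      · rw [involutionGraph_adj hf hne] at h
        subst h
        rcases ih with rfl | rfl
        · exact Or.inr rfl
        · exact Or.inl (hf x)
  have : (Set.univ : Set V).ncard ≤ 2 :=
    (Set.ncard_le_ncard (fun z _ => hmem z) (Set.toFinite _)).trans ((Set.ncard_insert_le _ _).trans (by simp))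
  rw [Set.ncard_univ] at this
  omega

lemma SimpleGraph.IsCycles.exists_isHamiltonianCycle [DecidableEq V] {C : SimpleGraph V} (hC : C.IsCycles)
    (hconn : C.Preconnected) {v w : V} (hvw : C.Adj v w) :
    ∃ c : (⊤ : SimpleGraph V).Walk v v, c.IsHamiltonianCycle ∧ {e | e ∈ c.edges} = C.edgeSet := by
  obtain ⟨p, hp, hverts⟩ := hC.exists_cycle_toSubgraph_verts_eq_connectedComponentSupp
    (c := C.connectedComponentMk v) rfl ⟨w, hvw⟩
  have hsupp : ∀ x, x ∈ p.support := by
    intro x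
    rw [← SimpleGraph.Walk.mem_verts_toSubgraph, hverts]
    exact SimpleGraph.ConnectedComponent.sound (hconn x v)
  refine ⟨p.mapLe le_top, ?_, ?_⟩
  · rw [SimpleGraph.Walk.isHamiltonianCycle_iff_isCycle_and_support_count_tail_eq_one]
    refine ⟨hp.mapLe le_top, fun a => List.count_eq_one_of_mem ?_ ?_⟩
    · simpa using hp.support_nodup
    · rw [SimpleGraph.Walk.support_mapLe_eq_support]
      have ha := hsupp a
      rw [SimpleGraph.Walk.mem_support_iff] at ha
      rcases ha with rfl | ha
      · exact SimpleGraph.Walk.end_mem_tail_support hp.not_nil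
      · exact ha
  · ext e
    induction e with
    | _ x y =>
      classical
      have := Fintype.ofFinite V
      have h := hp.adj_toSubgraph_iff_of_isCycles hC
        ((SimpleGraph.Walk.mem_verts_toSubgraph p).2 (hsupp x)) y
      rw [← SimpleGraph.Subgraph.mem_edgeSet, SimpleGraph.Walk.mem_edges_toSubgraph] at h
      simpa using h

end HamiltonianCycle

theorem isPH_of_isLayered {V : Type} [DecidableEq V] [Finite V] {G : SimpleGraph V}
    {col : V → ℕ} {n : ℕ} {f : V → V} (hcard : 2 < Nat.card V)
    (hG : ∀ x y, col y = col x + 1 → G.Adj x y) (hcol : ∀ v, col v ≤ n)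
    (hf : IsLayered col n f) : IsPH G := by
  intro M hM
  obtain ⟨g, hg, hconn⟩ := IsLayered.exists_preconnected hM hcol hf
  have hgG : ∀ v, G.Adj v (g v) := fun v =>
    (hg.step v).elim (hG v (g v)) fun h => (hG (g v) v h).symm
  have hdisj := disjoint_involutionGraph hM hg.involutive hg.ne hconn hcard
  have hcyc := symmDiff_involutionGraph_isCycles hM hg.involutive hg.ne
  rw [hdisj.symmDiff_eq_sup] at hcyc
  have : Nonempty V := (Nat.card_pos_iff.1 (by omega)).1
  obtain ⟨v⟩ := this
  obtain ⟨c, hc, hedges⟩ := hcyc.exists_isHamiltonianCycle hconn (v := v) (w := g v)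
    (Or.inr ((involutionGraph_adj hg.involutive hg.ne).2 rfl))
  refine ⟨involutionSubgraph G g hg.involutive hgG,
    involutionSubgraph_isPerfectMatching G hg.involutive hgG, v, c, hc, ?_⟩
  rw [hedges, SimpleGraph.edgeSet_sup, ← involutionSubgraph_spanningCoe G hg.involutive hgG,
    SimpleGraph.Subgraph.edgeSet_spanningCoe, SimpleGraph.Subgraph.edgeSet_spanningCoe]

/-- For every `n ≥ 3`, the graph `A'[n,2]`, obtained from `A[n,2]` by deleting the four
edges `u_1 u_n`, `v_1 v_n`, `u_{n-1} v_1` and `u_n v_2`, has the PH-property. -/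
theorem accordion_two_deleted_isPH (n : ℕ) (hn : 3 ≤ n) :
    IsPH ((accordion n 2).deleteEdges
      {s(((false, 1) : Bool × ZMod n), (false, (n : ZMod n))),
       s((true, 1), (true, (n : ZMod n))),
       s((false, (n : ZMod n) - 1), (true, 1)),
       s((false, (n : ZMod n)), (true, 2))}) := by
  have : NeZero n := ⟨by omega⟩
  let col : Bool × ZMod n → ℕ := fun x => (x.2 - 1).val + (if x.1 then 0 else 1)
  have hlt : ∀ i : ZMod n, (i - 1).val < n := fun i => ZMod.val_lt _
  refine isPH_of_isLayered (col := col) (n := n) (f := fun x => (!x.1, x.2)) ?_ ?_ ?_ ⟨?_, ?_, ?_⟩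
  · simp
    omega
  · have hval : ∀ (i j : ZMod n) (k : ℕ), (j - 1).val = (i - 1).val + k → j = i + k := by
      intro i j k h
      have h' := congrArg (Nat.cast : ℕ → ZMod n) h
      rw [Nat.cast_add, ZMod.natCast_zmod_val, ZMod.natCast_zmod_val] at h'
      linear_combination h'
    have h0 : (0 - 1 : ZMod n).val = n - 1 := by
      rw [← ZMod.val_cast_of_lt (show n - 1 < n by omega), Nat.cast_sub (by omega)]
      simp
    have h1 : (1 - 1 : ZMod n).val = 0 := by simp
    have h2 : (2 - 1 : ZMod n).val = 1 := by
      rw [show (2 - 1 : ZMod n) = 1 by norm_num, ZMod.val_one'' (by omega)]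
    have h3 : (-1 - 1 : ZMod n).val = n - 2 := by
      rw [← ZMod.val_cast_of_lt (show n - 2 < n by omega), Nat.cast_sub (by omega)]
      norm_num
    rintro ⟨b, i⟩ ⟨d, j⟩ h
    rw [SimpleGraph.deleteEdges_adj]
    constructor
    · rw [accordion, SimpleGraph.fromRel_adj]
      refine ⟨by rintro heq; rw [heq] at h; omega, ?_⟩
      cases b <;> cases d <;> simp [col] at h
      · simpa using Or.inl (hval i j 1 h)
      · have := hval i j 2 h
        simp_all
      · have := hval i j 0 h
        simp_all
      · simpa using Or.inl (hval i j 1 h)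
    · intro hmem
      cases b <;> cases d <;> simp [col] at h hmem <;>
        rcases hmem with ⟨rfl, rfl⟩ | ⟨rfl, rfl⟩ <;> omega
  · rintro ⟨b, i⟩
    have := hlt i
    cases b <;> simp [col] <;> omega
  · rintro ⟨b, i⟩
    simp
  · rintro ⟨b, i⟩
    cases b <;> simp [col]
  · intro i hi
    refine ⟨(true, (i : ZMod n) + 1), ?_, ?_⟩ <;>
      simp [col, ZMod.val_cast_of_lt hi]
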